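/- Let 𝒞_k = {−p/(2(n+1)) : p = 0, 1, …, 2k−2}. If δ ∉ 𝒞_k, then R^k_δ is the internal direct sum of the subspaces R^{k,ℓ}_δ := X^ℓ(R^{k−ℓ}_δ ∩ ker i_α) for ℓ = 0, 1, …, k; that is, R^k_δ = ⊕_{ℓ=0}^k X^ℓ(R^{k−ℓ}_δ ∩ ker i_α). -/

import Mathlib

open scoped BigOperators

noncomputable section

/-- Points of `ℝ^{2n+1}`. -/
abbrev Vc (n : ℕ) : Type := Fin (2*n+1) → ℝ

/-- Partial derivative of `f : ℝ^ι → ℝ` in the `i`-th coordinate direction. -/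
def pd {ι : Type*} [Fintype ι] [DecidableEq ι] (i : ι) (f : (ι → ℝ) → ℝ) (x : ι → ℝ) : ℝ :=
  fderiv ℝ f x (Pi.single i 1)

/-- Index of the coordinate `p_i` in `ℝ^{2n+1}`. -/
def pIdx (n : ℕ) (i : Fin n) : Fin (2*n+1) := ⟨i.1, by have := i.isLt; omega⟩
/-- Index of the coordinate `q^i` in `ℝ^{2n+1}`. -/
def qIdx (n : ℕ) (i : Fin n) : Fin (2*n+1) := ⟨n + i.1, by have := i.isLt; omega⟩
/-- Index of the coordinate `t` in `ℝ^{2n+1}`. -/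
def tIdx (n : ℕ) : Fin (2*n+1) := ⟨2*n, by omega⟩

/-- The contact Hamiltonian vector field `X_h` of a function `h` on `ℝ^{2n+1}`. -/
def contactHam (n : ℕ) (h : Vc n → ℝ) (x : Vc n) : Vc n :=
  fun a =>
    if ha : a.1 < n then
      -pd (qIdx n ⟨a.1, ha⟩) h x - pd (tIdx n) h x * x a
    else if ha' : a.1 < 2*n then
      pd (pIdx n ⟨a.1 - n, by omega⟩) h x - pd (tIdx n) h x * x a
    else
      (∑ k : Fin n, (x (pIdx n k) * pd (pIdx n k) h x + x (qIdx n k) * pd (qIdx n k) h x))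
        - 2 * h x

/-- Base partial derivative `∂_i S` of a symbol `S(x;ξ)`. -/
def pdB (n : ℕ) (i : Fin (2*n+1)) (S : Vc n → Vc n → ℝ) (x ξ : Vc n) : ℝ :=
  fderiv ℝ (fun y => S y ξ) x (Pi.single i 1)

/-- Fiber partial derivative `∂_{ξ_i} S` of a symbol `S(x;ξ)`. -/
def pdF (n : ℕ) (i : Fin (2*n+1)) (S : Vc n → Vc n → ℝ) (x ξ : Vc n) : ℝ :=
  fderiv ℝ (fun ζ => S x ζ) ξ (Pi.single i 1)

/-- `S` belongs to `R^k_δ`: a smooth map from `ℝ^{2n+1}` into homogeneous polynomials of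
degree `k` in the fiber variables `ξ` (the density weight `δ + k/(n+1)` is recorded
through the actions and operators below). -/
def InR (n k : ℕ) (S : Vc n → Vc n → ℝ) : Prop :=
  ContDiff ℝ (⊤ : ℕ∞) (fun p : Vc n × Vc n => S p.1 p.2) ∧
  ∀ (x : Vc n) (c : ℝ) (ξ : Vc n), S x (c • ξ) = c ^ k * S x ξ

/-- The vertical cotangent lift of the contact form:
`i_α = (1/2)(Σ_j (p_j ∂_{ξ_{q^j}} − q^j ∂_{ξ_{p_j}}) − ∂_{ξ_t})`. -/
def iAlpha (n : ℕ) (S : Vc n → Vc n → ℝ) (x ξ : Vc n) : ℝ :=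
  (1/2) * ((∑ j : Fin n, (x (pIdx n j) * pdF n (qIdx n j) S x ξ
      - x (qIdx n j) * pdF n (pIdx n j) S x ξ)) - pdF n (tIdx n) S x ξ)

/-- The generalized contact Hamiltonian with weight constant `a` (equal to
`2(n+1)δ + k` on `R^k_δ`):
`X(S) = Σ_j (ξ_{q^j}∂_{p_j}S − ξ_{p_j}∂_{q^j}S) + ξ_t ℰ_s S − ⟨ℰ_s,ξ_s⟩∂_t S + a ξ_t S`. -/
def genHam (n : ℕ) (a : ℝ) (S : Vc n → Vc n → ℝ) (x ξ : Vc n) : ℝ :=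
  (∑ j : Fin n, (ξ (qIdx n j) * pdB n (pIdx n j) S x ξ
      - ξ (pIdx n j) * pdB n (qIdx n j) S x ξ))
  + ξ (tIdx n) * (∑ j : Fin n, (x (pIdx n j) * pdB n (pIdx n j) S x ξ
      + x (qIdx n j) * pdB n (qIdx n j) S x ξ))
  - (∑ j : Fin n, (x (pIdx n j) * ξ (pIdx n j) + x (qIdx n j) * ξ (qIdx n j)))
      * pdB n (tIdx n) S x ξ
  + a * ξ (tIdx n) * S x ξ

/-- `ℓ`-fold iteration `X^ℓ` of the generalized Hamiltonian, starting with weight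
constant `a` and increasing it by `1` at each step. -/
def genHamPow (n : ℕ) (a : ℝ) : ℕ → (Vc n → Vc n → ℝ) → (Vc n → Vc n → ℝ)
  | 0, S => S
  | ℓ+1, S => genHam n (a + ℓ) (genHamPow n a ℓ S)

/-- The action of a vector field `Xf` on `R^k_δ` with weight `w = δ + k/(n+1)`:
`L_{X}S = X(S) − Σ_{i,j}∂_jX^i ξ_i ∂_{ξ_j}S + w (div X) S`. -/
def LAct (n : ℕ) (w : ℝ) (Xf : Vc n → Vc n) (S : Vc n → Vc n → ℝ) (x ξ : Vc n) : ℝ :=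
  (∑ i, Xf x i * pdB n i S x ξ)
  - (∑ i, ∑ j, pd j (fun y => Xf y i) x * ξ i * pdF n j S x ξ)
  + w * (∑ i, pd i (fun y => Xf y i) x) * S x ξ

/-- Contact Hamiltonians of the generators of `sp_{2n+2}`: the functions
`1, p_i, q^i, t, p_ip_j, q^iq^j, p_jq^i, tp_i, tq^i, t²`. -/
def IsGen (n : ℕ) (h : Vc n → ℝ) : Prop :=
  h = (fun _ => 1) ∨
  (∃ i, h = fun x => x (pIdx n i)) ∨
  (∃ i, h = fun x => x (qIdx n i)) ∨
  h = (fun x => x (tIdx n)) ∨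
  (∃ i j, h = fun x => x (pIdx n i) * x (pIdx n j)) ∨
  (∃ i j, h = fun x => x (qIdx n i) * x (qIdx n j)) ∨
  (∃ i j, h = fun x => x (pIdx n j) * x (qIdx n i)) ∨
  (∃ i, h = fun x => x (tIdx n) * x (pIdx n i)) ∨
  (∃ i, h = fun x => x (tIdx n) * x (qIdx n i)) ∨
  h = (fun x => x (tIdx n) * x (tIdx n))

/-- The subspace `R^{k,ℓ}_δ = X^ℓ(R^{k−ℓ}_δ ∩ ker i_α)` of `R^k_δ`. -/
def Rsub (n : ℕ) (δ : ℝ) (k ℓ : ℕ) : Set (Vc n → Vc n → ℝ) :=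
  {T | ∃ S, InR n (k - ℓ) S ∧ (∀ x ξ, iAlpha n S x ξ = 0) ∧
    T = genHamPow n (2*((n : ℝ)+1)*δ + ((k - ℓ : ℕ) : ℝ)) ℓ S}

theorem InR.contDiff {n k : ℕ} {S : Vc n → Vc n → ℝ} (hS : InR n k S) :
    ContDiff ℝ (⊤ : ℕ∞) (Function.uncurry S) := hS.1

theorem contDiff_fderiv_uncurry {n : ℕ} {S : Vc n → Vc n → ℝ}
    (hS : ContDiff ℝ (⊤ : ℕ∞) (Function.uncurry S)) :
    ContDiff ℝ (⊤ : ℕ∞) (fderiv ℝ (Function.uncurry S)) :=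
  hS.fderiv_right (by simp)

theorem pdF_eq_fderiv {n : ℕ} {S : Vc n → Vc n → ℝ}
    (hS : Differentiable ℝ (Function.uncurry S)) (i : Fin (2*n+1)) (x ξ : Vc n) :
    pdF n i S x ξ = fderiv ℝ (Function.uncurry S) (x, ξ) (0, Pi.single i 1) := by
  have h := (hS (x, ξ)).hasFDerivAt.comp ξ (hasFDerivAt_prodMk_right x ξ)
  have h' : fderiv ℝ (fun ζ => S x ζ) ξ = _ := h.fderiv
  rw [pdF, h']
  simp

theorem pdB_eq_fderiv {n : ℕ} {S : Vc n → Vc n → ℝ}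
    (hS : Differentiable ℝ (Function.uncurry S)) (i : Fin (2*n+1)) (x ξ : Vc n) :
    pdB n i S x ξ = fderiv ℝ (Function.uncurry S) (x, ξ) (Pi.single i 1, 0) := by
  have h := HasFDerivAt.comp x (f := fun y => (y, ξ)) (hS (x, ξ)).hasFDerivAt
    (hasFDerivAt_prodMk_left x ξ)
  have h' : fderiv ℝ (fun y => S y ξ) x = _ := h.fderiv
  rw [pdB, h']
  simp

/-- The linear part of the contact form, as a fiber vector. -/
def alphaLin (n : ℕ) : Vc n →L[ℝ] Vc n :=
  ∑ j : Fin n,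
    ((ContinuousLinearMap.proj (R := ℝ) (φ := fun _ : Fin (2*n+1) => ℝ) (pIdx n j)).smulRight
        (Pi.single (qIdx n j) (1 : ℝ) : Vc n)
      - (ContinuousLinearMap.proj (R := ℝ) (φ := fun _ : Fin (2*n+1) => ℝ) (qIdx n j)).smulRight
        (Pi.single (pIdx n j) (1 : ℝ) : Vc n))

/-- The contact form at `x`, as a fiber vector. -/
def alphaVec (n : ℕ) (x : Vc n) : Vc n :=
  alphaLin n x - Pi.single (tIdx n) 1

/-- The base direction in which the generalized Hamiltonian differentiates. -/
def hamVec (n : ℕ) (x ξ : Vc n) : Vc n :=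
  (∑ j : Fin n, (ξ (qIdx n j) • (Pi.single (pIdx n j) 1 : Vc n)
      - ξ (pIdx n j) • (Pi.single (qIdx n j) 1 : Vc n)))
  + ξ (tIdx n) • (∑ j : Fin n, (x (pIdx n j) • (Pi.single (pIdx n j) 1 : Vc n)
      + x (qIdx n j) • (Pi.single (qIdx n j) 1 : Vc n)))
  - (∑ j : Fin n, (x (pIdx n j) * ξ (pIdx n j) + x (qIdx n j) * ξ (qIdx n j)))
      • (Pi.single (tIdx n) 1 : Vc n)

section Coordinates

variable {n : ℕ}

theorem index_cases (i : Fin (2*n+1)) :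
    (∃ j, i = pIdx n j) ∨ (∃ j, i = qIdx n j) ∨ i = tIdx n := by
  rcases i with ⟨i, hi⟩
  by_cases h : i < n
  · exact Or.inl ⟨⟨i, h⟩, rfl⟩
  · by_cases h' : i < 2*n
    · refine Or.inr (Or.inl ⟨⟨i - n, by omega⟩, ?_⟩)
      simp only [qIdx, Fin.mk.injEq]; omega
    · refine Or.inr (Or.inr ?_)
      simp only [tIdx, Fin.mk.injEq]; omega

@[simp] theorem pIdx_inj {i j : Fin n} : pIdx n i = pIdx n j ↔ i = j := by
  simp [pIdx, Fin.ext_iff]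

@[simp] theorem qIdx_inj {i j : Fin n} : qIdx n i = qIdx n j ↔ i = j := by
  simp [qIdx, Fin.ext_iff]

@[simp] theorem pIdx_ne_qIdx {i j : Fin n} : pIdx n i ≠ qIdx n j := by
  simp only [pIdx, qIdx, ne_eq, Fin.mk.injEq]; omega

@[simp] theorem pIdx_ne_tIdx {i : Fin n} : pIdx n i ≠ tIdx n := by
  simp only [pIdx, tIdx, ne_eq, Fin.mk.injEq]; omega

@[simp] theorem qIdx_ne_tIdx {i : Fin n} : qIdx n i ≠ tIdx n := by
  simp only [qIdx, tIdx, ne_eq, Fin.mk.injEq]; omega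

@[simp] theorem qIdx_ne_pIdx {i j : Fin n} : qIdx n i ≠ pIdx n j := pIdx_ne_qIdx.symm

@[simp] theorem tIdx_ne_pIdx {i : Fin n} : tIdx n ≠ pIdx n i := pIdx_ne_tIdx.symm

@[simp] theorem tIdx_ne_qIdx {i : Fin n} : tIdx n ≠ qIdx n i := qIdx_ne_tIdx.symm

@[simp] theorem alphaLin_pIdx (x : Vc n) (j : Fin n) :
    alphaLin n x (pIdx n j) = -x (qIdx n j) := by
  simp [alphaLin, Pi.single_apply]

@[simp] theorem alphaLin_qIdx (x : Vc n) (j : Fin n) :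
    alphaLin n x (qIdx n j) = x (pIdx n j) := by
  simp [alphaLin, Pi.single_apply]

@[simp] theorem alphaLin_tIdx (x : Vc n) : alphaLin n x (tIdx n) = 0 := by
  simp [alphaLin]

@[simp] theorem alphaVec_pIdx (x : Vc n) (j : Fin n) :
    alphaVec n x (pIdx n j) = -x (qIdx n j) := by
  simp [alphaVec]

@[simp] theorem alphaVec_qIdx (x : Vc n) (j : Fin n) :
    alphaVec n x (qIdx n j) = x (pIdx n j) := by
  simp [alphaVec]

@[simp] theorem alphaVec_tIdx (x : Vc n) : alphaVec n x (tIdx n) = -1 := by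
  simp [alphaVec]

@[simp] theorem hamVec_pIdx (x ξ : Vc n) (j : Fin n) :
    hamVec n x ξ (pIdx n j) = ξ (qIdx n j) + ξ (tIdx n) * x (pIdx n j) := by
  simp [hamVec, Pi.single_apply]

@[simp] theorem hamVec_qIdx (x ξ : Vc n) (j : Fin n) :
    hamVec n x ξ (qIdx n j) = -ξ (pIdx n j) + ξ (tIdx n) * x (qIdx n j) := by
  simp [hamVec, Pi.single_apply]

@[simp] theorem hamVec_tIdx (x ξ : Vc n) :
    hamVec n x ξ (tIdx n)
      = -∑ j : Fin n, (x (pIdx n j) * ξ (pIdx n j) + x (qIdx n j) * ξ (qIdx n j)) := by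
  simp [hamVec]

/-- The contact form annihilates the coefficients of the generalized Hamiltonian. -/
theorem hamVec_add_smul_alphaVec (x ξ : Vc n) (s : ℝ) :
    hamVec n x (ξ + s • alphaVec n x) = hamVec n x ξ := by
  ext i
  rcases index_cases i with ⟨j, rfl⟩ | ⟨j, rfl⟩ | rfl
  · simp; ring
  · simp; ring
  · simp only [hamVec_tIdx, Pi.add_apply, Pi.smul_apply, alphaVec_pIdx, alphaVec_qIdx, smul_eq_mul]
    congr 1
    exact Finset.sum_congr rfl fun j _ => by ring

theorem alphaLin_hamVec (x ξ : Vc n) :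
    alphaLin n (hamVec n x ξ) = ξ + ξ (tIdx n) • alphaVec n x := by
  ext i
  rcases index_cases i with ⟨j, rfl⟩ | ⟨j, rfl⟩ | rfl <;> simp [add_comm]

theorem hamVec_smul (x ξ : Vc n) (c : ℝ) : hamVec n x (c • ξ) = c • hamVec n x ξ := by
  ext i
  rcases index_cases i with ⟨j, rfl⟩ | ⟨j, rfl⟩ | rfl
  · simp; ring
  · simp; ring
  · simp only [hamVec_tIdx, Pi.smul_apply, smul_eq_mul, mul_neg, Finset.mul_sum]
    congr 1
    exact Finset.sum_congr rfl fun j _ => by ring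

theorem contDiff_hamVec :
    ContDiff ℝ (⊤ : ℕ∞) (fun p : Vc n × Vc n => hamVec n p.1 p.2) := by
  unfold hamVec
  fun_prop

theorem contDiff_alphaVec :
    ContDiff ℝ (⊤ : ℕ∞) (alphaVec n) := by
  unfold alphaVec
  fun_prop

end Coordinates

section Operators

variable {n k : ℕ} {S : Vc n → Vc n → ℝ}

theorem iAlpha_eq_fderiv (hS : Differentiable ℝ (Function.uncurry S)) (x ξ : Vc n) :
    iAlpha n S x ξ = (1/2) * fderiv ℝ (Function.uncurry S) (x, ξ) (0, alphaVec n x) := by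
  have h : ((0 : Vc n), alphaVec n x)
      = (∑ j : Fin n, (x (pIdx n j) • ((0 : Vc n), (Pi.single (qIdx n j) 1 : Vc n))
        - x (qIdx n j) • ((0 : Vc n), (Pi.single (pIdx n j) 1 : Vc n))))
        - ((0 : Vc n), (Pi.single (tIdx n) 1 : Vc n)) := by
    apply Prod.ext <;> simp [alphaVec, alphaLin, Prod.fst_sum, Prod.snd_sum]
  rw [h]
  simp only [iAlpha, pdF_eq_fderiv hS, map_sub, map_sum, map_smul, smul_eq_mul]

theorem genHam_eq_fderiv (hS : Differentiable ℝ (Function.uncurry S)) (a : ℝ) (x ξ : Vc n) :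
    genHam n a S x ξ = fderiv ℝ (Function.uncurry S) (x, ξ) (hamVec n x ξ, 0)
      + a * ξ (tIdx n) * S x ξ := by
  have h : (hamVec n x ξ, (0 : Vc n)) = ContinuousLinearMap.inl ℝ (Vc n) (Vc n) (hamVec n x ξ) :=
    rfl
  rw [h]
  simp only [genHam, pdB_eq_fderiv hS, hamVec, map_sub, map_add, map_sum, map_smul, smul_eq_mul,
    ContinuousLinearMap.inl_apply]

theorem InR.differentiable (hS : InR n k S) : Differentiable ℝ (Function.uncurry S) :=
  hS.contDiff.differentiable (by simp)

/-- Homogeneity of the derivative in directions scaled compatibly with the fibers. -/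
theorem InR.fderiv_smul (hS : InR n k S) (x ξ u v : Vc n) (c : ℝ) :
    fderiv ℝ (Function.uncurry S) (x, c • ξ) (u, c • v)
      = c ^ k * fderiv ℝ (Function.uncurry S) (x, ξ) (u, v) := by
  let L : (Vc n × Vc n) →L[ℝ] (Vc n × Vc n) :=
    (ContinuousLinearMap.id ℝ (Vc n)).prodMap (c • ContinuousLinearMap.id ℝ (Vc n))
  have h1 : HasFDerivAt (Function.uncurry S ∘ L)
      ((fderiv ℝ (Function.uncurry S) (x, c • ξ)).comp L) (x, ξ) :=
    HasFDerivAt.comp (f := L) (x, ξ) (hS.differentiable (x, c • ξ)).hasFDerivAt L.hasFDerivAt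
  have h2 : Function.uncurry S ∘ L = fun p => c ^ k * Function.uncurry S p := by
    funext p
    exact hS.2 p.1 c p.2
  rw [h2] at h1
  have h3 := h1.unique ((hS.differentiable (x, ξ)).hasFDerivAt.const_mul (c ^ k))
  simpa [L] using DFunLike.congr_fun h3 (u, v)

/-- Euler's identity in the fiber directions. -/
theorem InR.fderiv_euler (hS : InR n k S) (x ξ : Vc n) :
    fderiv ℝ (Function.uncurry S) (x, ξ) (0, ξ) = k * S x ξ := by
  have h1 : HasDerivAt (fun c : ℝ => Function.uncurry S (x, c • ξ))
      (fderiv ℝ (Function.uncurry S) (x, ξ) (0, ξ)) 1 := by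
    have hc : HasDerivAt (fun c : ℝ => (x, c • ξ)) ((0 : Vc n), ξ) 1 := by
      simpa using (hasDerivAt_const (1 : ℝ) x).prodMk ((hasDerivAt_id (1 : ℝ)).smul_const ξ)
    have hG : HasFDerivAt (Function.uncurry S) (fderiv ℝ (Function.uncurry S) (x, ξ))
        (x, (1 : ℝ) • ξ) := by
      simpa using (hS.differentiable (x, ξ)).hasFDerivAt
    exact hG.comp_hasDerivAt 1 hc
  have h2 : (fun c : ℝ => Function.uncurry S (x, c • ξ)) = fun c => c ^ k * S x ξ := by
    funext c
    exact hS.2 x c ξ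
  rw [h2] at h1
  have h3 := h1.unique ((hasDerivAt_pow k (1 : ℝ)).mul_const (S x ξ))
  simpa using h3

theorem InR.iAlpha (hS : InR n (k+1) S) : InR n k (iAlpha n S) := by
  constructor
  · have h := contDiff_fderiv_uncurry hS.contDiff
    simp only [iAlpha_eq_fderiv hS.differentiable]
    have := contDiff_alphaVec (n := n)
    fun_prop
  · intro x c ξ
    have key : ∀ c : ℝ, c ≠ 0 → _root_.iAlpha n S x (c • ξ) = c ^ k * _root_.iAlpha n S x ξ := by
      intro c hc
      rw [iAlpha_eq_fderiv hS.differentiable, iAlpha_eq_fderiv hS.differentiable]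
      have h := hS.fderiv_smul x ξ 0 (alphaVec n x) c
      have h0 : ((0 : Vc n), c • alphaVec n x) = c • ((0 : Vc n), alphaVec n x) := by simp
      rw [h0, map_smul, smul_eq_mul, pow_succ] at h
      have := mul_left_cancel₀ hc (h.trans (by ring :
        _ = c * (c ^ k * fderiv ℝ (Function.uncurry S) (x, ξ) (0, alphaVec n x))))
      rw [this]; ring
    have hcont : Continuous fun ζ => _root_.iAlpha n S x ζ := by
      simp only [iAlpha_eq_fderiv hS.differentiable]
      have := (contDiff_fderiv_uncurry hS.contDiff).continuous
      fun_prop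
    have heq : (fun c : ℝ => _root_.iAlpha n S x (c • ξ))
        = fun c => c ^ k * _root_.iAlpha n S x ξ :=
      Continuous.ext_on (dense_compl_singleton (0 : ℝ)) (by fun_prop) (by fun_prop) key
    exact congrFun heq c

theorem InR.iAlpha_eq_zero (hS : InR n 0 S) (x ξ : Vc n) : _root_.iAlpha n S x ξ = 0 := by
  have h (j : Fin (2*n+1)) : pdF n j S x ξ = 0 := by
    have hc : (fun ζ => S x ζ) = fun _ => S x 0 := by
      funext ζ
      simpa using (hS.2 x 0 ζ).symm
    rw [pdF, hc]
    simp
  simp [_root_.iAlpha, h]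

theorem InR.genHam (hS : InR n k S) (a : ℝ) : InR n (k+1) (genHam n a S) := by
  constructor
  · have h := contDiff_fderiv_uncurry hS.contDiff
    have h' := hS.1
    simp only [genHam_eq_fderiv hS.differentiable]
    have := contDiff_hamVec (n := n)
    fun_prop
  · intro x c ξ
    rw [genHam_eq_fderiv hS.differentiable, genHam_eq_fderiv hS.differentiable, hS.2, hamVec_smul]
    have h := hS.fderiv_smul x ξ (hamVec n x ξ) 0 c
    have h0 : (c • hamVec n x ξ, (0 : Vc n)) = c • (hamVec n x ξ, (0 : Vc n)) := by simp
    rw [smul_zero] at h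
    rw [h0, map_smul, h, pow_succ, smul_eq_mul, Pi.smul_apply, smul_eq_mul]
    ring

/-- The `sl₂`-type commutation relation between `i_α` and the generalized Hamiltonian. -/
theorem InR.iAlpha_genHam (hS : InR n k S) (a : ℝ) (x ξ : Vc n) :
    _root_.iAlpha n (_root_.genHam n a S) x ξ
      = _root_.genHam n (a - 1) (_root_.iAlpha n S) x ξ - (1/2) * (a + k) * S x ξ := by
  have hG2 := (contDiff_fderiv_uncurry hS.contDiff).differentiable (by simp)
  have hX := (hS.genHam a).differentiable
  have hD : Differentiable ℝ (Function.uncurry (_root_.iAlpha n S)) := by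
    have := (contDiff_alphaVec (n := n)).differentiable (by simp)
    have h : Function.uncurry (_root_.iAlpha n S) = fun p : Vc n × Vc n =>
        (1/2) * fderiv ℝ (Function.uncurry S) p (0, alphaVec n p.1) :=
      funext fun p => iAlpha_eq_fderiv hS.differentiable p.1 p.2
    rw [h]
    fun_prop
  set G := Function.uncurry S with hG
  set B := fderiv ℝ (fderiv ℝ G) (x, ξ)
  have hsymm : B (hamVec n x ξ, 0) (0, alphaVec n x) = B (0, alphaVec n x) (hamVec n x ξ, 0) :=
    (hS.contDiff.contDiffAt.isSymmSndFDerivAt (by simp; norm_cast)).eq _ _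
  -- derivative of `X S` along the contact form
  have h1 : fderiv ℝ (Function.uncurry (_root_.genHam n a S)) (x, ξ) (0, alphaVec n x)
      = B (0, alphaVec n x) (hamVec n x ξ, 0) - a * S x ξ
        + a * ξ (tIdx n) * fderiv ℝ G (x, ξ) (0, alphaVec n x) := by
    rw [← (hX (x, ξ)).lineDeriv_eq_fderiv]
    refine HasLineDerivAt.lineDeriv ?_
    unfold HasLineDerivAt
    have hGl : HasDerivAt (fun s : ℝ => G ((x, ξ) + s • ((0 : Vc n), alphaVec n x)))
        (fderiv ℝ G (x, ξ) (0, alphaVec n x)) 0 :=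
      (hS.differentiable (x, ξ)).hasFDerivAt.hasLineDerivAt _
    have hG2l : HasDerivAt (fun s : ℝ => fderiv ℝ G ((x, ξ) + s • ((0 : Vc n), alphaVec n x)))
        (B (0, alphaVec n x)) 0 :=
      (hG2 (x, ξ)).hasFDerivAt.hasLineDerivAt _
    have ht : HasDerivAt (fun s : ℝ => a * (ξ (tIdx n) - s)) (-a) 0 := by
      simpa using ((hasDerivAt_id (0 : ℝ)).const_sub (ξ (tIdx n))).const_mul a
    have := (hG2l.clm_apply (hasDerivAt_const (0 : ℝ) (hamVec n x ξ, (0 : Vc n)))).add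
      (ht.mul hGl)
    convert this using 1
    · funext s
      simp only [Function.uncurry, Prod.mk_add_mk, Prod.smul_mk, smul_zero, add_zero,
        Pi.add_apply, Pi.mul_apply, hG]
      rw [genHam_eq_fderiv hS.differentiable, hamVec_add_smul_alphaVec]
      simp [sub_eq_add_neg]
    · simp [hG]; ring
  -- derivative of `i_α S` along the Hamiltonian direction
  have h2 : fderiv ℝ (Function.uncurry (_root_.iAlpha n S)) (x, ξ) (hamVec n x ξ, 0)
      = (1/2) * (B (hamVec n x ξ, 0) (0, alphaVec n x)
        + fderiv ℝ G (x, ξ) (0, ξ + ξ (tIdx n) • alphaVec n x)) := by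
    rw [← (hD (x, ξ)).lineDeriv_eq_fderiv]
    refine HasLineDerivAt.lineDeriv ?_
    unfold HasLineDerivAt
    have hG2l : HasDerivAt (fun s : ℝ => fderiv ℝ G ((x, ξ) + s • (hamVec n x ξ, (0 : Vc n))))
        (B (hamVec n x ξ, 0)) 0 :=
      (hG2 (x, ξ)).hasFDerivAt.hasLineDerivAt _
    have hv : HasDerivAt
        (fun s : ℝ => ((0 : Vc n), alphaVec n x + s • (ξ + ξ (tIdx n) • alphaVec n x)))
        (0, ξ + ξ (tIdx n) • alphaVec n x) 0 := by
      have := ((hasDerivAt_id (0 : ℝ)).smul_const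
        (ξ + ξ (tIdx n) • alphaVec n x)).const_add (alphaVec n x)
      simpa using (hasDerivAt_const (0 : ℝ) (0 : Vc n)).prodMk this
    have := (hG2l.clm_apply hv).const_mul (1/2 : ℝ)
    refine (HasDerivAt.congr_deriv this (by simp)).congr_of_eventuallyEq
      (Filter.Eventually.of_forall fun s => ?_)
    have hs : alphaVec n (x + s • hamVec n x ξ)
        = alphaVec n x + s • (ξ + ξ (tIdx n) • alphaVec n x) := by
      rw [← alphaLin_hamVec, alphaVec, alphaVec, map_add, map_smul]
      abel
    simp only [Function.uncurry, Prod.mk_add_mk, Prod.smul_mk, smul_zero, add_zero]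
    rw [iAlpha_eq_fderiv hS.differentiable, hs]
  have h3 : ((0 : Vc n), ξ + ξ (tIdx n) • alphaVec n x)
      = (0, ξ) + ξ (tIdx n) • ((0 : Vc n), alphaVec n x) := by simp
  rw [iAlpha_eq_fderiv hX, genHam_eq_fderiv hD, h1, h2, h3, map_add, map_smul, hS.fderiv_euler,
    iAlpha_eq_fderiv hS.differentiable, hsymm, smul_eq_mul]
  ring

end Operators

section Linearity

variable {n k : ℕ}

theorem InR.smul {S : Vc n → Vc n → ℝ} (hS : InR n k S) (c : ℝ) : InR n k (c • S) := by
  refine ⟨contDiff_const.mul hS.1, fun x r ξ => ?_⟩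
  simp only [Pi.smul_apply, smul_eq_mul, hS.2]
  ring

theorem InR.sub {S T : Vc n → Vc n → ℝ} (hS : InR n k S) (hT : InR n k T) :
    InR n k (S - T) := by
  refine ⟨hS.1.sub hT.1, fun x r ξ => ?_⟩
  simp only [Pi.sub_apply, hS.2, hT.2]
  ring

theorem InR.sum {ι : Type*} (s : Finset ι) {F : ι → Vc n → Vc n → ℝ}
    (hF : ∀ i ∈ s, InR n k (F i)) : InR n k (∑ i ∈ s, F i) := by
  constructor
  · simp only [Finset.sum_apply]
    exact ContDiff.sum fun i hi => (hF i hi).1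
  · intro x c ξ
    simp only [Finset.sum_apply, Finset.mul_sum]
    exact Finset.sum_congr rfl fun i hi => (hF i hi).2 x c ξ

theorem iAlpha_smul {S : Vc n → Vc n → ℝ} (hS : InR n k S) (c : ℝ) :
    iAlpha n (c • S) = c • iAlpha n S := by
  funext x ξ
  have h : Function.uncurry (c • S) = c • Function.uncurry S := rfl
  rw [Pi.smul_apply, Pi.smul_apply, iAlpha_eq_fderiv (hS.smul c).differentiable,
    iAlpha_eq_fderiv hS.differentiable, h, fderiv_const_smul (hS.differentiable _)]
  simp only [_root_.smul_apply, smul_eq_mul]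
  ring

theorem genHam_smul {S : Vc n → Vc n → ℝ} (hS : InR n k S) (a c : ℝ) :
    genHam n a (c • S) = c • genHam n a S := by
  funext x ξ
  have h : Function.uncurry (c • S) = c • Function.uncurry S := rfl
  rw [Pi.smul_apply, Pi.smul_apply, genHam_eq_fderiv (hS.smul c).differentiable,
    genHam_eq_fderiv hS.differentiable, h, fderiv_const_smul (hS.differentiable _)]
  simp only [_root_.smul_apply, smul_eq_mul, Pi.smul_apply]
  ring

theorem iAlpha_sub {S T : Vc n → Vc n → ℝ} (hS : InR n k S) (hT : InR n k T) :
    iAlpha n (S - T) = iAlpha n S - iAlpha n T := by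
  funext x ξ
  have h : Function.uncurry (S - T) = Function.uncurry S - Function.uncurry T := rfl
  rw [Pi.sub_apply, Pi.sub_apply, iAlpha_eq_fderiv (hS.sub hT).differentiable,
    iAlpha_eq_fderiv hS.differentiable, iAlpha_eq_fderiv hT.differentiable, h,
    fderiv_sub (hS.differentiable _) (hT.differentiable _)]
  simp only [_root_.sub_apply]
  ring

theorem iAlpha_sum {ι : Type*} (s : Finset ι) {F : ι → Vc n → Vc n → ℝ}
    (hF : ∀ i ∈ s, InR n k (F i)) : iAlpha n (∑ i ∈ s, F i) = ∑ i ∈ s, iAlpha n (F i) := by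
  funext x ξ
  have h : Function.uncurry (∑ i ∈ s, F i) = ∑ i ∈ s, Function.uncurry (F i) := by
    funext p
    simp [Function.uncurry]
  rw [iAlpha_eq_fderiv (InR.sum s hF).differentiable, h,
    fderiv_sum fun i hi => (hF i hi).differentiable _]
  simp only [_root_.sum_apply, Finset.mul_sum, Finset.sum_apply]
  exact Finset.sum_congr rfl fun i hi => (iAlpha_eq_fderiv (hF i hi).differentiable x ξ).symm

end Linearity

section Decomposition

variable {n : ℕ} {δ : ℝ} {k ℓ : ℕ} {T : Vc n → Vc n → ℝ}

theorem mem_Rsub_zero :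
    T ∈ Rsub n δ k 0 ↔ InR n k T ∧ iAlpha n T = 0 := by
  constructor
  · rintro ⟨S, hS, h0, rfl⟩
    exact ⟨hS, funext fun x => funext fun ξ => h0 x ξ⟩
  · rintro ⟨hT, h0⟩
    exact ⟨T, hT, fun x ξ => by rw [h0]; rfl, rfl⟩

theorem mem_Rsub_succ (hℓ : ℓ ≤ k) :
    T ∈ Rsub n δ (k+1) (ℓ+1) ↔
      ∃ U ∈ Rsub n δ k ℓ, T = genHam n (2*((n : ℝ)+1)*δ + k) U := by
  have hc : 2*((n : ℝ)+1)*δ + ((k - ℓ : ℕ) : ℝ) + ℓ = 2*((n : ℝ)+1)*δ + k := by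
    push_cast [hℓ]; ring
  simp only [Rsub, Set.mem_ofPred_eq, Nat.add_sub_add_right, genHamPow, hc]
  constructor
  · rintro ⟨S, hS, h0, rfl⟩
    exact ⟨_, ⟨S, hS, h0, rfl⟩, rfl⟩
  · rintro ⟨_, ⟨S, hS, h0, rfl⟩, rfl⟩
    exact ⟨S, hS, h0, rfl⟩

theorem InR_of_mem_Rsub (hℓ : ℓ ≤ k) (hT : T ∈ Rsub n δ k ℓ) : InR n k T := by
  induction ℓ generalizing k T with
  | zero => exact (mem_Rsub_zero.1 hT).1
  | succ ℓ ih =>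
    obtain ⟨k, rfl⟩ : ∃ m, k = m + 1 := ⟨k - 1, by omega⟩
    obtain ⟨U, hU, rfl⟩ := (mem_Rsub_succ (by omega)).1 hT
    exact (ih (by omega) hU).genHam _

theorem smul_mem_Rsub (hℓ : ℓ ≤ k) (hT : T ∈ Rsub n δ k ℓ) (c : ℝ) :
    c • T ∈ Rsub n δ k ℓ := by
  induction ℓ generalizing k T with
  | zero =>
    obtain ⟨h, h0⟩ := mem_Rsub_zero.1 hT
    exact mem_Rsub_zero.2 ⟨h.smul c, by rw [iAlpha_smul h, h0, smul_zero]⟩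
  | succ ℓ ih =>
    obtain ⟨k, rfl⟩ : ∃ m, k = m + 1 := ⟨k - 1, by omega⟩
    obtain ⟨U, hU, rfl⟩ := (mem_Rsub_succ (by omega)).1 hT
    exact (mem_Rsub_succ (by omega)).2
      ⟨c • U, ih (by omega) hU, (genHam_smul (InR_of_mem_Rsub (by omega) hU) _ c).symm⟩

/-- On `R^{k,ℓ}_δ`, the composition `i_α ∘ X` acts by a scalar. -/
theorem iAlpha_genHam_of_mem_Rsub (hℓ : ℓ ≤ k) (hT : T ∈ Rsub n δ k ℓ) :
    iAlpha n (genHam n (2*((n : ℝ)+1)*δ + k) T)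
      = (-(1/2) * (ℓ + 1) * (2*((n : ℝ)+1)*δ + (2 * k - ℓ : ℝ))) • T := by
  induction ℓ generalizing k T with
  | zero =>
    obtain ⟨h, h0⟩ := mem_Rsub_zero.1 hT
    funext x ξ
    have hz : genHam n (2*((n : ℝ)+1)*δ + k - 1) (0 : Vc n → Vc n → ℝ) x ξ = 0 := by
      simp [genHam, pdB]
    rw [h.iAlpha_genHam, h0, hz]
    simp only [Pi.smul_apply, smul_eq_mul, Nat.cast_zero]
    ring
  | succ ℓ ih =>
    have hT' := InR_of_mem_Rsub hℓ hT
    obtain ⟨k, rfl⟩ : ∃ m, k = m + 1 := ⟨k - 1, by omega⟩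
    obtain ⟨U, hU, hTU⟩ := (mem_Rsub_succ (by omega)).1 hT
    have hU' := InR_of_mem_Rsub (by omega) hU
    funext x ξ
    have hw : 2*((n : ℝ)+1)*δ + ((k + 1 : ℕ) : ℝ) - 1 = 2*((n : ℝ)+1)*δ + k := by
      push_cast; ring
    rw [hT'.iAlpha_genHam, hw, hTU, ih (by omega) hU, genHam_smul hU', ← hTU]
    simp only [Pi.smul_apply, smul_eq_mul]
    push_cast
    ring

theorem iAlpha_genHam_scalar_ne_zero
    (hδ : ∀ p : ℕ, p + 2 ≤ 2 * (k + 1) → 2*((n : ℝ)+1)*δ + p ≠ 0) (hℓ : ℓ ≤ k) :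
    -(1/2) * ((ℓ : ℝ) + 1) * (2*((n : ℝ)+1)*δ + (2 * k - ℓ : ℝ)) ≠ 0 := by
  have h := hδ (2 * k - ℓ) (by omega)
  rw [Nat.cast_sub (by omega)] at h
  push_cast at h
  have : (ℓ : ℝ) + 1 ≠ 0 := by positivity
  exact mul_ne_zero (mul_ne_zero (by norm_num) this) h

theorem exists_decomposition
    (hδ : ∀ p : ℕ, p + 2 ≤ 2 * k → 2*((n : ℝ)+1)*δ + p ≠ 0) (hT : InR n k T) :
    ∃ f : Fin (k+1) → (Vc n → Vc n → ℝ), (∀ ℓ, f ℓ ∈ Rsub n δ k ℓ.1) ∧ T = ∑ ℓ, f ℓ := by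
  induction k generalizing T with
  | zero =>
    refine ⟨fun _ => T, fun ℓ => ?_, by simp⟩
    obtain rfl : ℓ = 0 := Fin.fin_one_eq_zero ℓ
    exact mem_Rsub_zero.2 ⟨hT, funext fun x => funext fun ξ => hT.iAlpha_eq_zero x ξ⟩
  | succ k ih =>
    obtain ⟨g, hg, hsum⟩ := ih (fun p hp => hδ p (by omega)) hT.iAlpha
    let c : Fin (k+1) → ℝ := fun ℓ =>
      -(1/2) * ((ℓ : ℕ) + 1) * (2*((n : ℝ)+1)*δ + (2 * k - (ℓ : ℕ) : ℝ))
    have hc (ℓ : Fin (k+1)) : c ℓ ≠ 0 := iAlpha_genHam_scalar_ne_zero hδ (by omega)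
    let F : Fin (k+1) → Vc n → Vc n → ℝ := fun ℓ =>
      (c ℓ)⁻¹ • genHam n (2*((n : ℝ)+1)*δ + k) (g ℓ)
    have hF (ℓ : Fin (k+1)) : F ℓ ∈ Rsub n δ (k+1) (ℓ + 1) :=
      smul_mem_Rsub (by omega) ((mem_Rsub_succ (by omega)).2 ⟨g ℓ, hg ℓ, rfl⟩) _
    have hFR (ℓ) : InR n (k+1) (F ℓ) := InR_of_mem_Rsub (by omega) (hF ℓ)
    have hDF (ℓ : Fin (k+1)) : iAlpha n (F ℓ) = g ℓ := by
      have hgR := InR_of_mem_Rsub (by omega) (hg ℓ)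
      rw [iAlpha_smul (hgR.genHam _), iAlpha_genHam_of_mem_Rsub (by omega) (hg ℓ), smul_smul,
        inv_mul_cancel₀ (hc ℓ), one_smul]
    have hFs := InR.sum Finset.univ fun ℓ _ => hFR ℓ
    refine ⟨Fin.cons (T - ∑ ℓ, F ℓ) F, fun ℓ => ?_, ?_⟩
    · refine Fin.cases ?_ (fun ℓ => ?_) ℓ
      · refine mem_Rsub_zero.2 ⟨hT.sub hFs, ?_⟩
        rw [Fin.cons_zero, iAlpha_sub hT hFs, iAlpha_sum _ fun ℓ _ => hFR ℓ, hsum]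
        simp [hDF]
      · simpa using hF ℓ
    · rw [Fin.sum_univ_succ]
      simp

theorem decomposition_unique
    (hδ : ∀ p : ℕ, p + 2 ≤ 2 * k → 2*((n : ℝ)+1)*δ + p ≠ 0)
    {f g : Fin (k+1) → (Vc n → Vc n → ℝ)} (hf : ∀ ℓ, f ℓ ∈ Rsub n δ k ℓ.1)
    (hg : ∀ ℓ, g ℓ ∈ Rsub n δ k ℓ.1) (h : ∑ ℓ, f ℓ = ∑ ℓ, g ℓ) : f = g := by
  induction k with
  | zero =>
    funext ℓ
    obtain rfl : ℓ = 0 := Fin.fin_one_eq_zero ℓ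
    simpa using h
  | succ k ih =>
    let c : Fin (k+1) → ℝ := fun ℓ =>
      -(1/2) * ((ℓ : ℕ) + 1) * (2*((n : ℝ)+1)*δ + (2 * k - (ℓ : ℕ) : ℝ))
    have hc (ℓ : Fin (k+1)) : c ℓ ≠ 0 := iAlpha_genHam_scalar_ne_zero hδ (by omega)
    have lower {f : Fin (k+1+1) → (Vc n → Vc n → ℝ)} (hf : ∀ ℓ, f ℓ ∈ Rsub n δ (k+1) ℓ.1) :
        ∃ U : Fin (k+1) → (Vc n → Vc n → ℝ), (∀ ℓ, U ℓ ∈ Rsub n δ k ℓ.1) ∧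
          (∀ ℓ, f ℓ.succ = genHam n (2*((n : ℝ)+1)*δ + k) (U ℓ)) ∧
          iAlpha n (∑ ℓ, f ℓ) = ∑ ℓ, c ℓ • U ℓ := by
      have hs (ℓ : Fin (k+1)) := (mem_Rsub_succ (by omega)).1 (hf ℓ.succ)
      choose U hU hfU using hs
      refine ⟨U, hU, hfU, ?_⟩
      rw [iAlpha_sum _ fun ℓ _ => InR_of_mem_Rsub (by omega) (hf ℓ), Fin.sum_univ_succ,
        (mem_Rsub_zero.1 (hf 0)).2, zero_add]
      exact Finset.sum_congr rfl fun ℓ _ => by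
        rw [hfU, iAlpha_genHam_of_mem_Rsub (by omega) (hU ℓ)]
    obtain ⟨U, hU, hfU, hDf⟩ := lower hf
    obtain ⟨V, hV, hgV, hDg⟩ := lower hg
    have hUV := ih (fun p hp => hδ p (by omega)) (f := fun ℓ => c ℓ • U ℓ)
      (g := fun ℓ => c ℓ • V ℓ) (fun ℓ => smul_mem_Rsub (by omega) (hU ℓ) _)
      (fun ℓ => smul_mem_Rsub (by omega) (hV ℓ) _) (by rw [← hDf, ← hDg, h])
    have hsucc (ℓ : Fin (k+1)) : f ℓ.succ = g ℓ.succ := by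
      rw [hfU, hgV, smul_right_injective _ (hc ℓ) (congrFun hUV ℓ)]
    funext ℓ
    refine Fin.cases ?_ hsucc ℓ
    rw [Fin.sum_univ_succ f, Fin.sum_univ_succ g, Finset.sum_congr rfl fun ℓ _ => hsucc ℓ] at h
    exact add_right_cancel h

end Decomposition

/-- If `δ ∉ 𝒞_k = {−p/(2(n+1)) : p = 0,…,2k−2}`, then
`R^k_δ = ⊕_{ℓ=0}^k X^ℓ(R^{k−ℓ}_δ ∩ ker i_α)`: every `S ∈ R^k_δ` admits a unique
decomposition into components lying in the subspaces `R^{k,ℓ}_δ`. -/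
theorem stmt9 (n : ℕ) (hn : 1 ≤ n) (k : ℕ) (δ : ℝ)
    (hδ : ∀ p : ℕ, (p : ℤ) ≤ 2*(k : ℤ) - 2 → δ ≠ -(p : ℝ)/(2*((n : ℝ)+1))) :
    ∀ S, InR n k S → ∃! f : Fin (k+1) → (Vc n → Vc n → ℝ),
      (∀ ℓ : Fin (k+1), f ℓ ∈ Rsub n δ k ℓ.1) ∧
      (∀ x ξ, S x ξ = ∑ ℓ : Fin (k+1), f ℓ x ξ) := by
  have hA : ∀ p : ℕ, p + 2 ≤ 2 * k → 2*((n : ℝ)+1)*δ + p ≠ 0 := by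
    intro p hp h
    have hn' : 2*((n : ℝ)+1) ≠ 0 := by positivity
    refine hδ p (by omega) ?_
    rw [eq_div_iff hn']
    linarith
  intro S hS
  obtain ⟨f, hf, hsum⟩ := exists_decomposition hA hS
  refine ⟨f, ⟨hf, fun x ξ => by rw [hsum]; simp⟩, ?_⟩
  rintro g ⟨hg, hgs⟩
  refine decomposition_unique hA hg hf ?_
  rw [← hsum]
  funext x ξ
  simp [hgs]
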